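/- arXiv:2604.17783 — 2 statements merged into one kernel-verified Lean document; each statement's English description precedes it below -/
import Mathlib

section
/- Let 𝒮 be an η-sparse family of dyadic cubes, σ_1,…,σ_n weights in A_∞, K : 𝒮 → [0,∞), and 1 < p_1,…,p_n < ∞ with 1/p_1 + ⋯ + 1/p_n ≥ 1. If A_0 := sup_{S∈𝒮} K(S)|S|^{n - 1/p_1 - ⋯ - 1/p_n} ∏_{i=1}^n (σ_i(S)/|S|)^{1/p_i'} < ∞, then the multilinear embedding inequality ∑_{S∈𝒮} K(S) ∏_{i=1}^n ∫_S f_i dσ_i ≲ A_0 ∏_{i=1}^n ‖f_i‖_{L^{p_i}(σ_i)} holds for all nonnegative locally integrable f_1,…,f_n. -/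
open MeasureTheory ENNReal

/-- The axis-parallel cube in `ℝ^d` with center `c` and side length `ℓ`. -/
noncomputable def cube (d : ℕ) (c : EuclideanSpace ℝ (Fin d)) (ℓ : ℝ) :
    Set (EuclideanSpace ℝ (Fin d)) := {x | ∀ i, |x i - c i| ≤ ℓ / 2}

/-- The `A_p` characteristic of a weight `w` on `ℝ^d`. -/
noncomputable def apConst (d : ℕ) (p : ℝ) (w : EuclideanSpace ℝ (Fin d) → ℝ≥0∞) : ℝ≥0∞ :=
  ⨆ (c : EuclideanSpace ℝ (Fin d)) (ℓ : ℝ) (_ : 0 < ℓ),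
    ((∫⁻ x in cube d c ℓ, w x) / volume (cube d c ℓ)) *
      ((∫⁻ x in cube d c ℓ, w x ^ (-(1 / (p - 1)))) / volume (cube d c ℓ)) ^ (p - 1)

/-- `w ∈ A_∞` iff `w ∈ A_p` for some `1 < p < ∞`. -/
def isAinfty (d : ℕ) (w : EuclideanSpace ℝ (Fin d) → ℝ≥0∞) : Prop :=
  ∃ p : ℝ, 1 < p ∧ apConst d p w ≠ ⊤

/-- The dyadic cube `2^{-k}(m + [0,1)^d)` in `ℝ^d`. -/
def dyadicCube (d : ℕ) (k : ℤ) (m : Fin d → ℤ) :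
    Set (EuclideanSpace ℝ (Fin d)) :=
  {x | ∀ i, x i ∈ Set.Ico ((2:ℝ) ^ (-k) * m i) ((2:ℝ) ^ (-k) * (m i + 1))}

open scoped NNReal

theorem ENNReal.tsum_rpow_le_rpow_tsum {ι : Type*} (b : ι → ℝ≥0∞) {P : ℝ} (hP : 1 ≤ P) :
    ∑' j, b j ^ P ≤ (∑' j, b j) ^ P := by
  classical
  have hfin (s : Finset ι) : ∑ j ∈ s, b j ^ P ≤ (∑ j ∈ s, b j) ^ P := by
    induction s using Finset.induction with
    | empty => simp
    | insert a s ha ih =>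
      rw [Finset.sum_insert ha, Finset.sum_insert ha]
      exact (add_le_add_right ih _).trans (ENNReal.add_rpow_le_rpow_add _ _ hP)
  refine ENNReal.summable.tsum_le_of_sum_le fun s ↦ (hfin s).trans ?_
  exact ENNReal.rpow_le_rpow (ENNReal.sum_le_tsum s) (by positivity)

/-- Hölder's inequality for sums, with exponents adding up to at least `1`. -/
theorem ENNReal.tsum_prod_rpow_le {ι κ : Type*} [Fintype κ] (b : κ → ι → ℝ≥0∞) (r : κ → ℝ)
    (hr : ∀ i, 0 ≤ r i) (hsum : 1 ≤ ∑ i, r i) :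
    ∑' j, ∏ i, b i j ^ r i ≤ ∏ i, (∑' j, b i j) ^ r i := by
  set P := ∑ i, r i with hPdef
  have hP : 0 < P := by linarith
  let _ : MeasurableSpace ι := ⊤
  have hmul (i : κ) : P * (r i / P) = r i := by field_simp
  have key := lintegral_prod_norm_pow_le (μ := Measure.count) Finset.univ
    (f := fun i j ↦ b i j ^ P) (fun i _ ↦ (measurable_from_top).aemeasurable)
    (p := fun i ↦ r i / P) (by rw [← Finset.sum_div, ← hPdef, div_self hP.ne'])
    (fun i _ ↦ div_nonneg (hr i) hP.le)
  simp only [lintegral_count, ← ENNReal.rpow_mul, hmul] at key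
  refine key.trans (Finset.prod_le_prod' fun i _ ↦ ?_)
  refine (ENNReal.rpow_le_rpow (ENNReal.tsum_rpow_le_rpow_tsum _ hsum)
    (div_nonneg (hr i) hP.le)).trans_eq ?_
  rw [← ENNReal.rpow_mul, hmul]

theorem measure_biUnion_le_of_nested {α ι : Type*} [MeasurableSpace α] {μ ν : Measure α}
    {S : ι → Set α} (hS : ∀ j, MeasurableSet (S j))
    (hnest : ∀ i j, Disjoint (S i) (S j) ∨ S i ⊆ S j ∨ S j ⊆ S i)
    (t : Finset ι) (h : ∀ j ∈ t, μ (S j) ≤ ν (S j)) :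
    μ (⋃ j ∈ t, S j) ≤ ν (⋃ j ∈ t, S j) := by
  classical
  induction t using Finset.strongInduction with
  | H t ih =>
    rcases t.eq_empty_or_nonempty with rfl | hne
    · simp
    obtain ⟨a, ha, hmax⟩ := t.exists_maximalFor S hne
    set u := t.filter fun j ↦ Disjoint (S a) (S j) ∧ ¬ S j ⊆ S a with hu
    have hau : a ∉ u := by simp [hu]
    have hut : u ⊂ t := (Finset.ssubset_iff_of_subset (Finset.filter_subset _ _)).2 ⟨a, ha, hau⟩
    have heq : ⋃ j ∈ t, S j = S a ∪ ⋃ j ∈ u, S j := by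
      apply Set.Subset.antisymm
      · refine Set.iUnion₂_subset fun j hj ↦ ?_
        by_cases hja : S j ⊆ S a
        · exact hja.trans Set.subset_union_left
        · have hd : Disjoint (S a) (S j) := by
            rcases hnest a j with h | h | h
            · exact h
            · exact absurd (hmax hj h) hja
            · exact absurd h hja
          refine Set.Subset.trans ?_ Set.subset_union_right
          exact Set.subset_biUnion_of_mem (u := S) (show j ∈ (u : Set ι) by simp [hu, hj, hd, hja])
      · refine Set.union_subset (Set.subset_biUnion_of_mem (u := S) (show a ∈ (t : Set ι) from ha))
          (Set.biUnion_subset_biUnion_left hut.1)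
    have hdisj : Disjoint (S a) (⋃ j ∈ u, S j) := by
      rw [Set.disjoint_iUnion₂_right]
      intro j hj
      exact (Finset.mem_filter.1 hj).2.1
    have hm : MeasurableSet (⋃ j ∈ u, S j) := u.measurableSet_biUnion fun j _ ↦ hS j
    rw [heq, measure_union hdisj hm, measure_union hdisj hm]
    exact add_le_add (h a ha) (ih u hut fun j hj ↦ h j (hut.1 hj))

/-- The maximal function over the sets `S j`, `j ∈ s`, of the values `a j`. -/
noncomputable def finiteMaximal {α ι : Type*} (S : ι → Set α) (a : ι → ℝ≥0) (s : Finset ι)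
    (x : α) : ℝ≥0 := s.sup fun j ↦ (S j).indicator (fun _ ↦ a j) x

theorem lt_finiteMaximal_iff {α ι : Type*} {S : ι → Set α} {a : ι → ℝ≥0} {s : Finset ι}
    {x : α} {t : ℝ≥0} :
    t < finiteMaximal S a s x ↔ ∃ j ∈ s, x ∈ S j ∧ t < a j := by
  classical
  rw [finiteMaximal, Finset.lt_sup_iff]
  refine exists_congr fun j ↦ and_congr_right fun _ ↦ ?_
  by_cases hx : x ∈ S j <;> simp [hx]

theorem measurable_finiteMaximal {α ι : Type*} [MeasurableSpace α] {S : ι → Set α}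
    (hS : ∀ j, MeasurableSet (S j)) (a : ι → ℝ≥0) (s : Finset ι) :
    Measurable (finiteMaximal S a s) := by
  refine measurable_of_Ioi fun t ↦ ?_
  have : finiteMaximal S a s ⁻¹' Set.Ioi t = ⋃ j ∈ {j ∈ s | t < a j}, S j := by
    ext x
    simp only [Set.mem_preimage, Set.mem_Ioi, lt_finiteMaximal_iff, Set.mem_iUnion,
      Finset.mem_filter, exists_prop]
    exact exists_congr fun j ↦ by tauto
  rw [this]
  exact Finset.measurableSet_biUnion _ fun j _ ↦ hS j

theorem le_finiteMaximal {α ι : Type*} {S : ι → Set α} {a : ι → ℝ≥0} {s : Finset ι}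
    {x : α} {j : ι} (hj : j ∈ s) (hx : x ∈ S j) : a j ≤ finiteMaximal S a s x := by
  have := Finset.le_sup (f := fun j ↦ (S j).indicator (fun _ ↦ a j) x) hj
  rwa [Set.indicator_of_mem hx] at this

/-- Weak type estimate for the maximal function of a nested family. -/
theorem mul_measure_lt_finiteMaximal_le {α ι : Type*} [MeasurableSpace α] {μ ν : Measure α}
    {S : ι → Set α} (hS : ∀ j, MeasurableSet (S j))
    (hnest : ∀ i j, Disjoint (S i) (S j) ∨ S i ⊆ S j ∨ S j ⊆ S i)
    {a : ι → ℝ≥0} {s : Finset ι} (ha : ∀ j ∈ s, a j * μ (S j) ≤ ν (S j)) (t : ℝ≥0) :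
    t * μ {x | t < finiteMaximal S a s x} ≤ ν {x | t < finiteMaximal S a s x} := by
  classical
  have heq : {x | t < finiteMaximal S a s x} = ⋃ j ∈ s.filter (fun j ↦ t < a j), S j := by
    ext x
    simp only [Set.mem_ofPred_eq, lt_finiteMaximal_iff, Set.mem_iUnion, Finset.mem_filter,
      exists_prop]
    exact exists_congr fun j ↦ by tauto
  rw [heq]
  refine measure_biUnion_le_of_nested (μ := t • μ) hS hnest _ fun j hj ↦ ?_
  obtain ⟨hj, hlt⟩ := Finset.mem_filter.1 hj
  refine le_trans ?_ (ha j hj)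
  change (t : ℝ≥0∞) * μ (S j) ≤ _
  gcongr

/-- The strong type estimate for the maximal function of a nested family. -/
theorem lintegral_finiteMaximal_rpow_le {α ι : Type*} [MeasurableSpace α] {μ : Measure α}
    {S : ι → Set α} (hS : ∀ j, MeasurableSet (S j))
    (hnest : ∀ i j, Disjoint (S i) (S j) ∨ S i ⊆ S j ∨ S j ⊆ S i)
    {a : ι → ℝ≥0} {s : Finset ι} {f : α → ℝ≥0∞} (hf : Measurable f) {p : ℝ} (hp : 1 < p)
    (hμ : ∀ j ∈ s, μ (S j) ≠ ⊤) (ha : ∀ j ∈ s, a j * μ (S j) ≤ ∫⁻ x in S j, f x ∂μ) :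
    ∫⁻ x, (finiteMaximal S a s x : ℝ≥0∞) ^ p ∂μ ≤
      ENNReal.ofReal (p / (p - 1)) ^ p * ∫⁻ x, f x ^ p ∂μ := by
  classical
  set M := finiteMaximal S a s with hM
  have hMm : Measurable M := measurable_finiteMaximal hS a s
  have hp0 : 0 < p := by linarith
  have hp1 : 0 < p - 1 := by linarith
  set X := ∫⁻ x, (M x : ℝ≥0∞) ^ p ∂μ with hX
  set Y := ∫⁻ x, f x ^ p ∂μ with hY
  set ν := μ.withDensity f with hν
  have hconv (r : ℝ) (hr : 0 < r) (m : Measure α) : ∫⁻ x, (M x : ℝ≥0∞) ^ r ∂m =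
      ENNReal.ofReal r * ∫⁻ t in Set.Ioi (0 : ℝ), m {x | t < (M x : ℝ)} *
        ENNReal.ofReal (t ^ (r - 1)) := by
    rw [← lintegral_rpow_eq_lintegral_meas_lt_mul m (f := fun x ↦ (M x : ℝ))
      (.of_forall fun x ↦ (M x).2) hMm.coe_nnreal_real.aemeasurable hr]
    refine lintegral_congr fun x ↦ ?_
    rw [← ENNReal.ofReal_rpow_of_nonneg (NNReal.coe_nonneg _) hr.le, ENNReal.ofReal_coe_nnreal]
  have hweak : ∫⁻ t in Set.Ioi (0 : ℝ), μ {x | t < (M x : ℝ)} * ENNReal.ofReal (t ^ (p - 1)) ≤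
      ∫⁻ t in Set.Ioi (0 : ℝ), ν {x | t < (M x : ℝ)} * ENNReal.ofReal (t ^ (p - 1 - 1)) := by
    refine setLIntegral_mono' measurableSet_Ioi fun t ht ↦ ?_
    have ht : 0 < t := ht
    lift t to ℝ≥0 using ht.le
    simp only [NNReal.coe_lt_coe]
    have hpow : (t : ℝ) ^ (p - 1) = t * (t : ℝ) ^ (p - 1 - 1) := by
      rw [Real.rpow_sub_one ht.ne' (p - 1)]; field_simp
    rw [hpow, ENNReal.ofReal_mul ht.le, ENNReal.ofReal_coe_nnreal, ← mul_assoc]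
    refine mul_le_mul_left ?_ _
    rw [mul_comm]
    refine mul_measure_lt_finiteMaximal_le hS hnest (fun j hj ↦ ?_) t
    rw [hν, withDensity_apply _ (hS j)]
    exact ha j hj
  have hXfin : X ≠ ⊤ := by
    have hle (x : α) : (M x : ℝ≥0∞) ^ p ≤
        ∑ j ∈ s, (S j).indicator (fun _ ↦ (a j : ℝ≥0∞) ^ p) x := by
      rcases s.eq_empty_or_nonempty with rfl | hne
      · simp [hM, finiteMaximal, hp0]
      obtain ⟨j, hj, hjx⟩ := s.exists_mem_eq_sup hne fun j ↦ (S j).indicator (fun _ ↦ a j) x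
      have : M x = (S j).indicator (fun _ ↦ a j) x := hjx
      rw [this]
      refine le_trans ?_ (Finset.single_le_sum (f := fun j ↦ (S j).indicator
        (fun _ ↦ (a j : ℝ≥0∞) ^ p) x) (fun _ _ ↦ zero_le) hj)
      by_cases hx : x ∈ S j <;> simp [hx, hp0]
    refine ne_top_of_le_ne_top ?_ (lintegral_mono hle)
    rw [lintegral_finsetSum _ fun j _ ↦ measurable_const.indicator (hS j)]
    refine ENNReal.sum_ne_top.2 fun j hj ↦ ?_
    rw [lintegral_indicator_const (hS j)]
    exact ENNReal.mul_ne_top (ENNReal.rpow_ne_top_of_nonneg hp0.le ENNReal.coe_ne_top) (hμ j hj)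
  have hpq : p.HolderConjugate (p / (p - 1)) := Real.HolderConjugate.conjExponent hp
  have hhol : ∫⁻ x, (M x : ℝ≥0∞) ^ (p - 1) ∂ν ≤ Y ^ (1 / p) * X ^ (1 / (p / (p - 1))) := by
    rw [hν, lintegral_withDensity_eq_lintegral_mul _ hf
      (hMm.coe_nnreal_ennreal.pow_const _)]
    refine (ENNReal.lintegral_mul_le_Lp_mul_Lq μ hpq hf.aemeasurable
      (hMm.coe_nnreal_ennreal.pow_const _).aemeasurable).trans_eq ?_
    simp only [← ENNReal.rpow_mul, hX]
    rw [mul_div_cancel₀ p hp1.ne']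
  have hmain : X ≤ ENNReal.ofReal (p / (p - 1)) * (Y ^ (1 / p) * X ^ (1 / (p / (p - 1)))) := by
    refine le_trans ?_ (mul_le_mul_right hhol _)
    rw [hX, hconv p hp0, hconv (p - 1) hp1, ← mul_assoc, ← ENNReal.ofReal_mul (by positivity),
      div_mul_cancel₀ _ hp1.ne']
    gcongr
  rcases eq_or_ne X 0 with h0 | h0
  · simp [h0]
  have hexp : X = X ^ (1 / p) * X ^ (1 / (p / (p - 1))) := by
    rw [← ENNReal.rpow_add _ _ h0 hXfin]
    have : 1 / p + 1 / (p / (p - 1)) = 1 := by field_simp; ring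
    rw [this, ENNReal.rpow_one]
  have hZ0 : X ^ (1 / (p / (p - 1))) ≠ 0 := by
    simp [ENNReal.rpow_eq_zero_iff, h0, hXfin]
  have hZt : X ^ (1 / (p / (p - 1))) ≠ ⊤ :=
    ENNReal.rpow_ne_top_of_nonneg (by positivity) hXfin
  have hfinal : X ^ (1 / p) ≤ ENNReal.ofReal (p / (p - 1)) * Y ^ (1 / p) := by
    rw [← ENNReal.mul_le_mul_iff_left hZ0 hZt, ← hexp, mul_assoc]
    exact hmain
  have := ENNReal.rpow_le_rpow hfinal hp0.le
  rwa [ENNReal.mul_rpow_of_nonneg _ _ hp0.le, ← ENNReal.rpow_mul, ← ENNReal.rpow_mul,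
    one_div_mul_cancel hp0.ne', ENNReal.rpow_one, ENNReal.rpow_one] at this

/-- The Carleson embedding theorem for a nested family. -/
theorem tsum_measure_mul_average_rpow_le {α ι : Type*} [MeasurableSpace α] {μ : Measure α}
    {S E : ι → Set α} (hS : ∀ j, MeasurableSet (S j))
    (hnest : ∀ i j, Disjoint (S i) (S j) ∨ S i ⊆ S j ∨ S j ⊆ S i)
    (hE : ∀ j, MeasurableSet (E j)) (hES : ∀ j, E j ⊆ S j)
    (hdisj : Pairwise (Function.onFun Disjoint E)) {C : ℝ≥0∞}
    (hC : ∀ j, μ (S j) ≤ C * μ (E j)) {f : α → ℝ≥0∞} (hf : Measurable f)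
    {p : ℝ} (hp : 1 < p) :
    ∑' j, μ (S j) * ((∫⁻ x in S j, f x ∂μ) / μ (S j)) ^ p ≤
      C * ENNReal.ofReal (p / (p - 1)) ^ p * ∫⁻ x, f x ^ p ∂μ := by
  classical
  have hp0 : 0 < p := by linarith
  refine ENNReal.summable.tsum_le_of_sum_le fun s ↦ ?_
  by_cases hY : ∫⁻ x, f x ^ p ∂μ = ⊤
  · rcases eq_or_ne C 0 with rfl | hC0
    · simp only [zero_mul, nonpos_iff_eq_zero] at hC
      simp [hC]
    · rw [hY, ENNReal.mul_top]
      · exact le_top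
      · refine mul_ne_zero hC0 ?_
        have : 0 < p / (p - 1) := div_pos hp0 (by linarith)
        simp [ENNReal.rpow_eq_zero_iff, this]
  set u := {j ∈ s | μ (S j) ≠ 0 ∧ μ (S j) ≠ ⊤} with hu
  have hus : ∑ j ∈ u, μ (S j) * ((∫⁻ x in S j, f x ∂μ) / μ (S j)) ^ p =
      ∑ j ∈ s, μ (S j) * ((∫⁻ x in S j, f x ∂μ) / μ (S j)) ^ p := by
    refine Finset.sum_subset (Finset.filter_subset _ _) fun j hj hju ↦ ?_
    by_cases h0 : μ (S j) = 0
    · simp [h0]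
    · have ht : μ (S j) = ⊤ := by
        by_contra ht
        exact hju (Finset.mem_filter.2 ⟨hj, h0, ht⟩)
      simp [ht, hp0]
  rw [← hus]
  set a : ι → ℝ≥0 := fun j ↦ ((∫⁻ x in S j, f x ∂μ) / μ (S j)).toNNReal with ha
  have hint (j) (hj : j ∈ u) : ∫⁻ x in S j, f x ∂μ ≠ ⊤ := by
    have hle (x : α) : f x ≤ 1 + f x ^ p := by
      rcases le_total (f x) 1 with h | h
      · exact h.trans le_self_add
      · refine le_trans ?_ le_add_self
        simpa using ENNReal.rpow_le_rpow_of_exponent_le h hp.le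
    refine ne_top_of_le_ne_top ?_ (lintegral_mono hle)
    rw [lintegral_add_left measurable_const]
    simp only [lintegral_const, one_mul, Measure.restrict_apply_univ]
    exact ENNReal.add_ne_top.2 ⟨(Finset.mem_filter.1 hj).2.2,
      ne_top_of_le_ne_top hY (setLIntegral_le_lintegral _ _)⟩
  have hacoe (j) (hj : j ∈ u) : (a j : ℝ≥0∞) = (∫⁻ x in S j, f x ∂μ) / μ (S j) :=
    ENNReal.coe_toNNReal (ENNReal.div_ne_top (hint j hj) (Finset.mem_filter.1 hj).2.1)
  have hmax := lintegral_finiteMaximal_rpow_le (a := a) (s := u) hS hnest hf hp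
    (fun j hj ↦ (Finset.mem_filter.1 hj).2.2) fun j hj ↦ by
      rw [hacoe j hj]
      obtain ⟨_, h0, ht⟩ := Finset.mem_filter.1 hj
      exact (ENNReal.div_mul_cancel h0 ht).le
  calc ∑ j ∈ u, μ (S j) * ((∫⁻ x in S j, f x ∂μ) / μ (S j)) ^ p
      ≤ ∑ j ∈ u, C * ∫⁻ x in E j, (finiteMaximal S a u x : ℝ≥0∞) ^ p ∂μ := by
        refine Finset.sum_le_sum fun j hj ↦ ?_
        rw [← hacoe j hj]
        refine (mul_le_mul_left (hC j) _).trans ?_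
        rw [mul_assoc]
        refine mul_le_mul_right ?_ _
        rw [mul_comm, ← setLIntegral_const]
        refine setLIntegral_mono' (hE j) fun x hx ↦ ?_
        have := le_finiteMaximal (a := a) hj (hES j hx)
        gcongr
    _ = C * ∫⁻ x in ⋃ j ∈ u, E j, (finiteMaximal S a u x : ℝ≥0∞) ^ p ∂μ := by
        rw [lintegral_biUnion_finset (fun i _ j _ hij ↦ hdisj hij) fun j _ ↦ hE j,
          Finset.mul_sum]
    _ ≤ C * ∫⁻ x, (finiteMaximal S a u x : ℝ≥0∞) ^ p ∂μ := by
        gcongr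
        exact Measure.restrict_le_self
    _ ≤ _ := by
        rw [mul_assoc]
        gcongr

theorem dyadicCube_eq_preimage (d : ℕ) (k : ℤ) (m : Fin d → ℤ) :
    dyadicCube d k m = WithLp.ofLp ⁻¹' Set.univ.pi fun i ↦
      Set.Ico ((2 : ℝ) ^ (-k) * m i) ((2 : ℝ) ^ (-k) * (m i + 1)) := by
  ext x
  simp [dyadicCube]

theorem measurableSet_dyadicCube (d : ℕ) (k : ℤ) (m : Fin d → ℤ) :
    MeasurableSet (dyadicCube d k m) := by
  rw [dyadicCube_eq_preimage]
  exact (PiLp.volume_preserving_ofLp (Fin d)).measurable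
    (MeasurableSet.univ_pi fun _ ↦ measurableSet_Ico)

theorem volume_dyadicCube (d : ℕ) (k : ℤ) (m : Fin d → ℤ) :
    volume (dyadicCube d k m) = ENNReal.ofReal ((2 : ℝ) ^ (-k)) ^ d := by
  rw [dyadicCube_eq_preimage, (PiLp.volume_preserving_ofLp (Fin d)).measure_preimage
    (MeasurableSet.univ_pi fun _ ↦ measurableSet_Ico).nullMeasurableSet, Real.volume_pi_Ico]
  simp [mul_add]

theorem cube_eq_preimage (d : ℕ) (c : EuclideanSpace ℝ (Fin d)) (ℓ : ℝ) :
    cube d c ℓ = WithLp.ofLp ⁻¹' Set.univ.pi fun i ↦ Set.Icc (c i - ℓ / 2) (c i + ℓ / 2) := by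
  ext x
  simp only [cube, Set.mem_ofPred_eq, Set.mem_preimage, Set.mem_pi, Set.mem_univ, true_imp_iff,
    Set.mem_Icc, abs_le]
  exact forall_congr' fun i ↦ ⟨fun h ↦ ⟨by linarith [h.1], by linarith [h.2]⟩,
    fun h ↦ ⟨by linarith [h.1], by linarith [h.2]⟩⟩

theorem measurableSet_cube (d : ℕ) (c : EuclideanSpace ℝ (Fin d)) (ℓ : ℝ) :
    MeasurableSet (cube d c ℓ) := by
  rw [cube_eq_preimage]
  exact (PiLp.volume_preserving_ofLp (Fin d)).measurable
    (MeasurableSet.univ_pi fun _ ↦ measurableSet_Icc)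

theorem volume_cube (d : ℕ) (c : EuclideanSpace ℝ (Fin d)) (ℓ : ℝ) :
    volume (cube d c ℓ) = ENNReal.ofReal ℓ ^ d := by
  rw [cube_eq_preimage, (PiLp.volume_preserving_ofLp (Fin d)).measure_preimage
    (MeasurableSet.univ_pi fun _ ↦ measurableSet_Icc).nullMeasurableSet, Set.pi_univ_Icc,
    Real.volume_Icc_pi]
  simp

theorem exists_dyadicCube_subset_cube (d : ℕ) (k : ℤ) (m : Fin d → ℤ) :
    ∃ c : EuclideanSpace ℝ (Fin d), dyadicCube d k m ⊆ cube d c ((2 : ℝ) ^ (-k)) := by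
  refine ⟨WithLp.toLp 2 fun i ↦ (2 : ℝ) ^ (-k) * (m i + 1 / 2), fun x hx i ↦ ?_⟩
  have := hx i
  rw [Set.mem_Ico] at this
  rw [abs_le]
  constructor <;> simp only <;> linarith [this.1, this.2]

theorem dyadicCube_subset_of_le {d : ℕ} {k₁ k₂ : ℤ} (hk : k₁ ≤ k₂) {m₁ m₂ : Fin d → ℤ}
    (h : ¬ Disjoint (dyadicCube d k₁ m₁) (dyadicCube d k₂ m₂)) :
    dyadicCube d k₂ m₂ ⊆ dyadicCube d k₁ m₁ := by
  obtain ⟨x, hx₁, hx₂⟩ := Set.not_disjoint_iff.1 h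
  intro y hy i
  have h₁ := hx₁ i
  have h₂ := hx₂ i
  have hy := hy i
  obtain ⟨N, rfl⟩ := Int.le.dest hk
  set δ : ℝ := (2 : ℝ) ^ (-(k₁ + N)) with hδ
  have hδ0 : 0 < δ := by positivity
  have hscale : (2 : ℝ) ^ (-k₁) = δ * ((2 ^ N : ℤ) : ℝ) := by
    rw [hδ]
    push_cast
    rw [← zpow_natCast, ← zpow_add₀ two_ne_zero]
    congr 1
    ring
  rw [hscale, Set.mem_Ico, mul_assoc, mul_assoc] at h₁ ⊢
  rw [Set.mem_Ico] at h₂ hy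
  have e₁ : 2 ^ N * m₁ i < m₂ i + 1 := by
    have := lt_of_mul_lt_mul_left (h₁.1.trans_lt h₂.2) hδ0.le
    exact_mod_cast this
  have e₂ : m₂ i < 2 ^ N * (m₁ i + 1) := by
    have := lt_of_mul_lt_mul_left (h₂.1.trans_lt h₁.2) hδ0.le
    rw [← Int.cast_lt (R := ℝ)]
    push_cast at this ⊢
    exact this
  have e₁' : ((2 ^ N : ℤ) : ℝ) * m₁ i ≤ m₂ i := by exact_mod_cast Int.lt_add_one_iff.1 e₁
  have e₂' : (m₂ i + 1 : ℝ) ≤ ((2 ^ N : ℤ) : ℝ) * (m₁ i + 1) := by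
    exact_mod_cast Int.add_one_le_iff.2 e₂
  exact ⟨(mul_le_mul_of_nonneg_left e₁' hδ0.le).trans hy.1,
    hy.2.trans_le (mul_le_mul_of_nonneg_left e₂' hδ0.le)⟩

theorem dyadicCube_nested {d : ℕ} (k₁ k₂ : ℤ) (m₁ m₂ : Fin d → ℤ) :
    Disjoint (dyadicCube d k₁ m₁) (dyadicCube d k₂ m₂) ∨
      dyadicCube d k₁ m₁ ⊆ dyadicCube d k₂ m₂ ∨ dyadicCube d k₂ m₂ ⊆ dyadicCube d k₁ m₁ := by
  by_cases h : Disjoint (dyadicCube d k₁ m₁) (dyadicCube d k₂ m₂)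
  · exact .inl h
  rcases le_total k₁ k₂ with hk | hk
  · exact .inr (.inr (dyadicCube_subset_of_le hk h))
  · exact .inr (.inl (dyadicCube_subset_of_le hk fun h' ↦ h h'.symm))

/-- A Hölder estimate relating the size of a set to its mass for a weight and the dual weight. -/
theorem measure_rpow_le_lintegral_mul {α : Type*} [MeasurableSpace α] {μ : Measure α}
    {w : α → ℝ≥0∞} (hw : Measurable w) {q : ℝ} (hq : 1 < q)
    (h0 : ∀ᵐ x ∂μ, w x ≠ 0) (ht : ∀ᵐ x ∂μ, w x ≠ ⊤) :
    μ Set.univ ^ q ≤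
      (∫⁻ x, w x ∂μ) * (∫⁻ x, w x ^ (-(1 / (q - 1))) ∂μ) ^ (q - 1) := by
  have hq0 : 0 < q := by linarith
  have hq1 : 0 < q - 1 := by linarith
  have hpq : q.HolderConjugate (q / (q - 1)) := Real.HolderConjugate.conjExponent hq
  have key := ENNReal.lintegral_mul_le_Lp_mul_Lq μ hpq (hw.pow_const (1 / q)).aemeasurable
    (hw.pow_const (-(1 / q))).aemeasurable
  have hone : ∫⁻ x, ((fun x ↦ w x ^ (1 / q)) * fun x ↦ w x ^ (-(1 / q))) x ∂μ = μ Set.univ := by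
    rw [← lintegral_one]
    refine lintegral_congr_ae ?_
    filter_upwards [h0, ht] with x hx0 hxt
    simp only [Pi.mul_apply]
    rw [← ENNReal.rpow_add _ _ hx0 hxt, add_neg_cancel, ENNReal.rpow_zero]
  have hexp : -(1 / q) * (q / (q - 1)) = -(1 / (q - 1)) := by field_simp
  rw [hone] at key
  simp only [← ENNReal.rpow_mul, one_div_mul_cancel hq0.ne', ENNReal.rpow_one, hexp] at key
  refine (ENNReal.rpow_le_rpow key hq0.le).trans_eq ?_
  rw [ENNReal.mul_rpow_of_nonneg _ _ hq0.le, ← ENNReal.rpow_mul, ← ENNReal.rpow_mul,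
    one_div_mul_cancel hq0.ne', ENNReal.rpow_one]
  congr 2
  field_simp

/-- `A_∞` weights of subsets occupying a fixed proportion of a dyadic cube control the weight of
the cube. -/
theorem isAinfty.exists_lintegral_dyadicCube_le {d : ℕ} {w : EuclideanSpace ℝ (Fin d) → ℝ≥0∞}
    (hw : Measurable w) (hA : isAinfty d w) {η : ℝ} (hη : 0 < η) :
    ∃ C : ℝ≥0∞, C ≠ ⊤ ∧ ∀ (k : ℤ) (m : Fin d → ℤ) (E : Set (EuclideanSpace ℝ (Fin d))),
      MeasurableSet E → E ⊆ dyadicCube d k m →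
      ENNReal.ofReal η * volume (dyadicCube d k m) ≤ volume E →
      ∫⁻ x in dyadicCube d k m, w x ≤ C * ∫⁻ x in E, w x := by
  obtain ⟨q, hq, hA⟩ := hA
  have hq0 : 0 < q := by linarith
  have hq1 : 0 < q - 1 := by linarith
  set h : ℝ≥0∞ := ENNReal.ofReal η ^ q with hh
  have hh0 : h ≠ 0 := by simp [hh, ENNReal.rpow_eq_zero_iff, hη]
  have hht : h ≠ ⊤ := ENNReal.rpow_ne_top_of_nonneg hq0.le ENNReal.ofReal_ne_top
  refine ⟨(apConst d q w + 1) / h,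
    ENNReal.div_ne_top (ENNReal.add_ne_top.2 ⟨hA, ENNReal.one_ne_top⟩) hh0,
    fun k m E hE hES hEη ↦ ?_⟩
  obtain ⟨c, hc⟩ := exists_dyadicCube_subset_cube d k m
  set Q := cube d c ((2 : ℝ) ^ (-k)) with hQ
  set V := volume Q with hV
  have hVeq : volume (dyadicCube d k m) = V := by
    rw [hV, hQ, volume_dyadicCube, volume_cube]
  have hV0 : V ≠ 0 := by
    rw [hV, hQ, volume_cube]
    exact pow_ne_zero _ (by simp; positivity)
  have hVt : V ≠ ⊤ := by
    rw [hV, hQ, volume_cube]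
    exact ENNReal.pow_ne_top ENNReal.ofReal_ne_top
  rw [hVeq] at hEη
  have hEQ : E ⊆ Q := hES.trans hc
  set W := ∫⁻ x in Q, w x with hW
  set W' := ∫⁻ x in Q, w x ^ (-(1 / (q - 1))) with hW'
  refine (lintegral_mono_set hc).trans ?_
  change W ≤ _
  rcases eq_or_ne W 0 with hW0 | hW0
  · simp [hW0]
  have hAQ : W / V * (W' / V) ^ (q - 1) ≤ apConst d q w := by
    refine le_trans ?_ (le_iSup_of_le c (le_iSup_of_le ((2 : ℝ) ^ (-k))
      (le_iSup_of_le (by positivity) le_rfl)))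
    exact le_rfl
  have hW't : W' ≠ ⊤ := by
    intro htop
    refine hA (top_le_iff.1 (le_trans (top_le_iff.2 ?_) hAQ))
    rw [htop, ENNReal.top_div_of_ne_top hVt, ENNReal.top_rpow_of_pos hq1, ENNReal.mul_top]
    exact ENNReal.div_ne_zero.2 ⟨hW0, hVt⟩
  by_cases hWE : ∫⁻ x in E, w x = ⊤
  · rw [hWE, ENNReal.mul_top]
    · exact le_top
    · exact ENNReal.div_ne_zero.2 ⟨by simp, hht⟩
  have hne0 : ∀ᵐ x ∂volume.restrict E, w x ≠ 0 := by
    have hlt := ae_lt_top (hw.pow_const (-(1 / (q - 1)))) hW't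
    filter_upwards [ae_restrict_of_ae_restrict_of_subset hEQ hlt] with x hx hx0
    rw [hx0, ENNReal.zero_rpow_of_neg (by simpa using hq1)] at hx
    exact lt_irrefl _ hx
  have hnet : ∀ᵐ x ∂volume.restrict E, w x ≠ ⊤ :=
    (ae_lt_top hw hWE).mono fun x hx ↦ hx.ne
  have hhol := measure_rpow_le_lintegral_mul hw hq hne0 hnet
  rw [Measure.restrict_apply_univ] at hhol
  have hVq0 : V ^ q ≠ 0 := by simp [ENNReal.rpow_eq_zero_iff, hV0, hVt]
  have hVqt : V ^ q ≠ ⊤ := ENNReal.rpow_ne_top_of_nonneg hq0.le hVt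
  have hAQ' : W * W' ^ (q - 1) ≤ (apConst d q w + 1) * V ^ q := by
    have hpow : V ^ q = V * V ^ (q - 1) := by
      nth_rewrite 2 [← ENNReal.rpow_one V]
      rw [← ENNReal.rpow_add _ _ hV0 hVt]
      congr 1
      ring
    calc W * W' ^ (q - 1) = W / V * (W' / V) ^ (q - 1) * V ^ q := by
          nth_rewrite 1 [← ENNReal.div_mul_cancel hV0 hVt (b := W),
            ← ENNReal.div_mul_cancel hV0 hVt (b := W')]
          rw [ENNReal.mul_rpow_of_nonneg _ _ hq1.le, hpow]
          ring
      _ ≤ _ := by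
          gcongr
          exact hAQ.trans le_self_add
  rw [← ENNReal.mul_le_mul_iff_left (mul_ne_zero hh0 hVq0) (ENNReal.mul_ne_top hht hVqt)]
  calc W * (h * V ^ q) = W * (ENNReal.ofReal η * V) ^ q := by
        rw [ENNReal.mul_rpow_of_nonneg _ _ hq0.le]
    _ ≤ W * volume E ^ q := by gcongr
    _ ≤ W * ((∫⁻ x in E, w x) * W' ^ (q - 1)) := by
        gcongr
        refine hhol.trans ?_
        gcongr
        exact lintegral_mono_set hEQ
    _ = (W * W' ^ (q - 1)) * ∫⁻ x in E, w x := by ring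
    _ ≤ ((apConst d q w + 1) * V ^ q) * ∫⁻ x in E, w x := by gcongr
    _ = (apConst d q w + 1) / h * h * V ^ q * ∫⁻ x in E, w x := by
        rw [ENNReal.div_mul_cancel hh0 hht]
    _ = _ := by ring

theorem ENNReal.rpow_sum {ι : Type*} {x : ℝ≥0∞} (h0 : x ≠ 0) (ht : x ≠ ⊤) (s : Finset ι)
    (r : ι → ℝ) : x ^ ∑ i ∈ s, r i = ∏ i ∈ s, x ^ r i := by
  classical
  induction s using Finset.induction with
  | empty => simp
  | insert a s ha ih => rw [Finset.sum_insert ha, Finset.prod_insert ha,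
      ENNReal.rpow_add _ _ h0 ht, ih]

theorem mul_prod_le_of_mul_prod_rpow_le {κ : Type*} [Fintype κ] {p : κ → ℝ} (hp : ∀ i, 1 < p i)
    {K A v : ℝ≥0∞} {V N : κ → ℝ≥0∞} (hv0 : v ≠ 0) (hvt : v ≠ ⊤)
    (hN : ∀ i, V i = 0 → N i = 0) (hA : A ≠ ⊤)
    (h : K * v ^ (∑ i, (1 - 1 / p i)) * ∏ i, (V i / v) ^ (1 - 1 / p i) ≤ A) :
    K * ∏ i, N i ≤ A * ∏ i, (V i * (N i / V i) ^ p i) ^ (1 / p i) := by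
  have hp0 (i) : 0 < p i := zero_lt_one.trans (hp i)
  have hr (i) : 0 < 1 - 1 / p i := by
    rw [sub_pos, div_lt_one (hp0 i)]
    exact hp i
  rw [ENNReal.rpow_sum hv0 hvt, mul_assoc, ← Finset.prod_mul_distrib] at h
  simp only [← ENNReal.mul_rpow_of_nonneg _ _ (hr _).le, ENNReal.mul_div_cancel hv0 hvt] at h
  by_cases h0 : ∃ i, V i = 0
  · obtain ⟨i, hi⟩ := h0
    rw [Finset.prod_eq_zero (Finset.mem_univ i) (hN i hi), mul_zero]
    exact zero_le
  push Not at h0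
  by_cases ht : ∃ i, V i = ⊤
  · obtain ⟨i, hi⟩ := ht
    have hprod : ∏ i, V i ^ (1 - 1 / p i) = ⊤ := by
      classical
      rw [← Finset.mul_prod_erase _ _ (Finset.mem_univ i), hi, ENNReal.top_rpow_of_pos (hr i),
        ENNReal.top_mul]
      refine Finset.prod_ne_zero_iff.2 fun j _ ↦ ?_
      rw [Ne, ENNReal.rpow_eq_zero_iff]
      rintro (⟨hj, -⟩ | ⟨-, hj⟩)
      · exact h0 j hj
      · exact (hr j).not_gt hj
    have hK : K = 0 := by
      by_contra hK
      rw [hprod, ENNReal.mul_top hK] at h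
      exact hA (top_le_iff.1 h)
    simp [hK]
  push Not at ht
  have hfac (i) : N i = V i ^ (1 - 1 / p i) * (V i * (N i / V i) ^ p i) ^ (1 / p i) := by
    rw [ENNReal.mul_rpow_of_nonneg _ _ (by have := hp0 i; positivity), ← ENNReal.rpow_mul,
      mul_one_div_cancel (hp0 i).ne', ENNReal.rpow_one, ← mul_assoc,
      ← ENNReal.rpow_add _ _ (h0 i) (ht i), sub_add_cancel, ENNReal.rpow_one,
      ENNReal.mul_div_cancel (h0 i) (ht i)]
  calc K * ∏ i, N i
      = (K * ∏ i, V i ^ (1 - 1 / p i)) * ∏ i, (V i * (N i / V i) ^ p i) ^ (1 / p i) := by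
        rw [mul_assoc, ← Finset.prod_mul_distrib]
        exact congrArg _ (Finset.prod_congr rfl fun i _ ↦ hfac i)
    _ ≤ _ := by gcongr

/-- Theorem 2.1(a): for `σᵢ ∈ A_∞` and `∑ 1/pᵢ ≥ 1`, if
`A₀ = sup_S K(S)|S|^{n-∑1/pᵢ} ∏ (σᵢ(S)/|S|)^{1/pᵢ'} < ∞` (here `1/pᵢ' = 1 - 1/pᵢ`),
then the multilinear embedding inequality holds. -/
theorem stmt6 (d n : ℕ) (hn : 0 < n) (p : Fin n → ℝ) (hp : ∀ i, 1 < p i)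
    (hsum : 1 ≤ ∑ i, 1 / p i) (η : ℝ) (hη0 : 0 < η) (hη1 : η < 1)
    (σ : Fin n → EuclideanSpace ℝ (Fin d) → ℝ≥0∞) (hσm : ∀ i, Measurable (σ i))
    (hσA : ∀ i, isAinfty d (σ i)) :
    ∃ C : ℝ≥0∞, C ≠ ⊤ ∧
      ∀ (ι : Type) (_ : Countable ι) (k : ι → ℤ) (m : ι → Fin d → ℤ)
        (E : ι → Set (EuclideanSpace ℝ (Fin d)))
        (_ : ∀ j, MeasurableSet (E j))
        (_ : ∀ j, E j ⊆ dyadicCube d (k j) (m j))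
        (_ : ∀ j, ENNReal.ofReal η * volume (dyadicCube d (k j) (m j)) ≤ volume (E j))
        (_ : Pairwise (Function.onFun Disjoint E))
        (K : ι → ℝ≥0∞) (A₀ : ℝ≥0∞) (_ : A₀ ≠ ⊤)
        (_ : ∀ j, K j * volume (dyadicCube d (k j) (m j)) ^ ((n : ℝ) - ∑ i, 1 / p i) *
            ∏ i, ((∫⁻ x in dyadicCube d (k j) (m j), σ i x) /
              volume (dyadicCube d (k j) (m j))) ^ (1 - 1 / p i) ≤ A₀)
        (f : Fin n → EuclideanSpace ℝ (Fin d) → ℝ≥0∞) (_ : ∀ i, Measurable (f i)),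
        (∑' j, K j * ∏ i, ∫⁻ x in dyadicCube d (k j) (m j), f i x * σ i x) ≤
          C * A₀ * ∏ i, (∫⁻ x, f i x ^ p i * σ i x) ^ (1 / p i) := by
  choose c hct hc using fun i ↦ (hσA i).exists_lintegral_dyadicCube_le (hσm i) hη0
  have hp0 (i) : 0 < p i := zero_lt_one.trans (hp i)
  set D : Fin n → ℝ≥0∞ := fun i ↦ c i * ENNReal.ofReal (p i / (p i - 1)) ^ p i with hD
  have hDt (i) : D i ≠ ⊤ := ENNReal.mul_ne_top (hct i)
    (ENNReal.rpow_ne_top_of_nonneg (hp0 i).le ENNReal.ofReal_ne_top)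
  have hr (i) : 0 ≤ 1 / p i := (one_div_pos.2 (hp0 i)).le
  refine ⟨∏ i, D i ^ (1 / p i), ENNReal.prod_ne_top fun i _ ↦
    ENNReal.rpow_ne_top_of_nonneg (hr i) (hDt i), ?_⟩
  intro ι _ k m E hE hES hEη hdisj K A₀ hA₀ hK f hf
  set S : ι → Set (EuclideanSpace ℝ (Fin d)) := fun j ↦ dyadicCube d (k j) (m j) with hS
  have hSm (j) : MeasurableSet (S j) := measurableSet_dyadicCube d (k j) (m j)
  set μ : Fin n → Measure (EuclideanSpace ℝ (Fin d)) := fun i ↦ volume.withDensity (σ i) with hμ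
  have hμS (i) {T : Set (EuclideanSpace ℝ (Fin d))} (hT : MeasurableSet T) :
      ∫⁻ x in T, σ i x = μ i T := (withDensity_apply _ hT).symm
  have hint (i) {g : EuclideanSpace ℝ (Fin d) → ℝ≥0∞} (hg : Measurable g) :
      ∫⁻ x, g x * σ i x = ∫⁻ x, g x ∂μ i := by
    rw [hμ, lintegral_withDensity_eq_lintegral_mul _ (hσm i) hg]
    simp [mul_comm]
  have hintS (i j) : ∫⁻ x in S j, f i x * σ i x = ∫⁻ x in S j, f i x ∂μ i := by
    rw [hμ, setLIntegral_withDensity_eq_setLIntegral_mul _ (hσm i) (hf i) (hSm j)]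
    simp [mul_comm]
  set b : Fin n → ι → ℝ≥0∞ :=
    fun i j ↦ μ i (S j) * ((∫⁻ x in S j, f i x ∂μ i) / μ i (S j)) ^ p i with hb
  have hexp : (n : ℝ) - ∑ i, 1 / p i = ∑ i, (1 - 1 / p i) := by simp
  have hterm (j) : K j * ∏ i, ∫⁻ x in S j, f i x * σ i x ≤ A₀ * ∏ i, b i j ^ (1 / p i) := by
    simp only [hintS]
    refine mul_prod_le_of_mul_prod_rpow_le (v := volume (S j)) hp ?_ ?_ (fun i hi ↦ ?_) hA₀ ?_
    · rw [hS, volume_dyadicCube]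
      exact pow_ne_zero _ (by simp; positivity)
    · rw [hS, volume_dyadicCube]
      exact ENNReal.pow_ne_top ENNReal.ofReal_ne_top
    · exact setLIntegral_measure_zero _ _ hi
    · rw [← hexp]
      simp only [← hμS _ (hSm j)]
      exact hK j
  have hcarl (i) : ∑' j, b i j ≤ D i * ∫⁻ x, f i x ^ p i * σ i x := by
    rw [hint i ((hf i).pow_const _)]
    refine tsum_measure_mul_average_rpow_le hSm (fun _ _ ↦ dyadicCube_nested _ _ _ _) hE hES hdisj
      (fun j ↦ ?_) (hf i) (hp i)
    rw [← hμS i (hSm j), ← hμS i (hE j)]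
    exact hc i (k j) (m j) (E j) (hE j) (hES j) (hEη j)
  calc ∑' j, K j * ∏ i, ∫⁻ x in S j, f i x * σ i x
      ≤ ∑' j, A₀ * ∏ i, b i j ^ (1 / p i) := ENNReal.tsum_le_tsum hterm
    _ = A₀ * ∑' j, ∏ i, b i j ^ (1 / p i) := ENNReal.tsum_mul_left
    _ ≤ A₀ * ∏ i, (∑' j, b i j) ^ (1 / p i) := by
        gcongr
        exact ENNReal.tsum_prod_rpow_le b _ hr hsum
    _ ≤ A₀ * ∏ i, (D i * ∫⁻ x, f i x ^ p i * σ i x) ^ (1 / p i) := by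
        gcongr with i
        · exact hr i
        · exact hcarl i
    _ = (∏ i, D i ^ (1 / p i)) * A₀ * ∏ i, (∫⁻ x, f i x ^ p i * σ i x) ^ (1 / p i) := by
        simp only [ENNReal.mul_rpow_of_nonneg _ _ (hr _), Finset.prod_mul_distrib]
        ring
end

section
/- Let 𝒮 be an η-sparse family of dyadic cubes, σ_1,…,σ_n weights, K : 𝒮 → [0,∞), 1 < p_1,…,p_n < ∞ with 1/p_1 + ⋯ + 1/p_n ≥ 1, and θ > 1. If A_0 := sup_{S∈𝒮} K(S)|S|^{n − 1/p_1 − ⋯ − 1/p_n} ∏_{i=1}^n ((∫_S σ_i^θ dx)/|S|)^{1/(θ p_i')} < ∞, then ∑_{S∈𝒮} K(S) ∏_{i=1}^n ∫_S f_i σ_i dx ≲ A_0 ∏_{i=1}^n ‖f_i‖_{L^{p_i}(σ_i)} for all nonnegative locally integrable f_1,…,f_n, with no A_∞ assumption on the σ_i. -/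
open MeasureTheory ENNReal

namespace SparseEmbedding

theorem lintegral_indicator_rpow_of_ne_top {s : ℝ} (hs : 0 < s) {x : ℝ≥0∞} (hx : x ≠ ⊤) :
    ∫⁻ t in Set.Ioi (0 : ℝ),
      Set.indicator {t : ℝ | ENNReal.ofReal t < x} (fun t => ENNReal.ofReal (t ^ (s - 1))) t
      = x ^ s / ENNReal.ofReal s := by
  have hset : MeasurableSet {t : ℝ | ENNReal.ofReal t < x} :=
    measurableSet_lt (by fun_prop) measurable_const
  rw [lintegral_indicator hset, Measure.restrict_restrict hset]
  have hI : {t : ℝ | ENNReal.ofReal t < x} ∩ Set.Ioi 0 = Set.Ioo 0 x.toReal := by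
    ext t
    simp only [Set.mem_inter_iff, Set.mem_ofPred_eq, Set.mem_Ioi, Set.mem_Ioo]
    constructor
    · rintro ⟨h1, h2⟩
      exact ⟨h2, (ENNReal.ofReal_lt_iff_lt_toReal h2.le hx).1 h1⟩
    · rintro ⟨h1, h2⟩
      exact ⟨(ENNReal.ofReal_lt_iff_lt_toReal h1.le hx).2 h2, h1⟩
  have hx0 : 0 ≤ x.toReal := ENNReal.toReal_nonneg
  have hint := intervalIntegral.intervalIntegrable_rpow' (a := 0) (b := x.toReal)
    (r := s - 1) (by linarith)
  rw [hI, ← ofReal_integral_eq_lintegral_ofReal, ← integral_Ioc_eq_integral_Ioo,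
    ← intervalIntegral.integral_of_le hx0, integral_rpow (Or.inl (by linarith)), sub_add_cancel,
    Real.zero_rpow hs.ne', sub_zero, ENNReal.ofReal_div_of_pos hs,
    ← ENNReal.ofReal_rpow_of_nonneg hx0 hs.le, ENNReal.ofReal_toReal hx]
  · rw [intervalIntegrable_iff_integrableOn_Ioc_of_le hx0] at hint
    exact hint.mono_set Set.Ioo_subset_Ioc_self
  · filter_upwards [ae_restrict_mem measurableSet_Ioo] with t ht
    exact Real.rpow_nonneg ht.1.le _

/-- Layer-cake formula for the powers of an extended nonnegative number. -/
theorem lintegral_indicator_rpow {s : ℝ} (hs : 0 < s) (x : ℝ≥0∞) :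
    ∫⁻ t in Set.Ioi (0 : ℝ),
      Set.indicator {t : ℝ | ENNReal.ofReal t < x} (fun t => ENNReal.ofReal (t ^ (s - 1))) t
      = x ^ s / ENNReal.ofReal s := by
  rcases eq_or_ne x ⊤ with rfl | hx
  · have hs0 : ENNReal.ofReal s ≠ 0 := by simpa using hs
    rw [ENNReal.top_rpow_of_pos hs, ENNReal.top_div_of_ne_top ENNReal.ofReal_ne_top]
    refine ENNReal.eq_top_of_forall_nnreal_le fun r => ?_
    have key : (((r : ℝ≥0∞) * ENNReal.ofReal s) ^ (1 / s)) ≠ ⊤ :=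
      ENNReal.rpow_ne_top_of_nonneg (by positivity)
        (ENNReal.mul_ne_top ENNReal.coe_ne_top ENNReal.ofReal_ne_top)
    have h := lintegral_indicator_rpow_of_ne_top hs key
    rw [← ENNReal.rpow_mul, one_div_mul_cancel hs.ne', ENNReal.rpow_one,
      ENNReal.mul_div_cancel_right hs0 ENNReal.ofReal_ne_top] at h
    rw [← h]
    refine lintegral_mono fun t => Set.indicator_le_indicator_of_subset ?_ (fun _ => zero_le) t
    intro t ht
    simp
  · exact lintegral_indicator_rpow_of_ne_top hs hx

theorem rpow_sum {κ : Type*} {x : ℝ≥0∞} (hx0 : x ≠ 0) (hxt : x ≠ ⊤) (s : Finset κ) (w : κ → ℝ) :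
    x ^ (∑ i ∈ s, w i) = ∏ i ∈ s, x ^ w i := by
  classical
  induction s using Finset.induction with
  | empty => simp
  | insert a s ha ih =>
    rw [Finset.sum_insert ha, Finset.prod_insert ha, ENNReal.rpow_add _ _ hx0 hxt, ih]

theorem sum_rpow_le_rpow_sum {ι : Type*} (s : Finset ι) (x : ι → ℝ≥0∞) {P : ℝ} (hP : 1 ≤ P) :
    ∑ j ∈ s, x j ^ P ≤ (∑ j ∈ s, x j) ^ P := by
  classical
  induction s using Finset.induction with
  | empty => simp
  | insert a s ha ih =>
    rw [Finset.sum_insert ha, Finset.sum_insert ha]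
    exact (add_le_add_right ih _).trans (ENNReal.add_rpow_le_rpow_add _ _ hP)

/-- Multilinear Hölder inequality for sums, with exponents of total mass at least one. -/
theorem sum_prod_rpow_le {ι κ : Type*} [Fintype κ] (s : Finset ι) (a : κ → ι → ℝ≥0∞)
    {w : κ → ℝ} (hw : ∀ i, 0 ≤ w i) (hsum : 1 ≤ ∑ i, w i) :
    ∑ j ∈ s, ∏ i, a i j ^ w i ≤ ∏ i, (∑ j ∈ s, a i j) ^ w i := by
  set P := ∑ i, w i with hP
  have hP0 : 0 < P := by linarith
  have hsplit : ∀ b : κ → ℝ≥0∞, ∏ i, b i ^ w i = (∏ i, b i ^ (w i / P)) ^ P := by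
    intro b
    rw [← ENNReal.prod_rpow_of_nonneg hP0.le]
    refine Finset.prod_congr rfl fun i _ => ?_
    rw [← ENNReal.rpow_mul, div_mul_cancel₀ _ hP0.ne']
  simp_rw [hsplit]
  refine (sum_rpow_le_rpow_sum s _ hsum).trans (ENNReal.rpow_le_rpow ?_ hP0.le)
  let _ : MeasurableSpace ι := ⊤
  have h := ENNReal.lintegral_prod_norm_pow_le (μ := ∑ j ∈ s, Measure.dirac j) Finset.univ (f := a)
    (fun i _ => (measurable_from_top).aemeasurable) (p := fun i => w i / P)
    (by rw [← Finset.sum_div, ← hP, div_self hP0.ne'])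
    (fun i _ => div_nonneg (hw i) hP0.le)
  simpa [lintegral_finsetSum_measure] using h

/-- A finite laminar family has a pairwise disjoint subfamily with the same union. -/
theorem exists_pairwiseDisjoint_subfamily {α ι : Type*} (Q : ι → Set α)
    (hQ : ∀ i j, Q i ⊆ Q j ∨ Q j ⊆ Q i ∨ Disjoint (Q i) (Q j)) (s : Finset ι) :
    ∃ t ⊆ s, (t : Set ι).PairwiseDisjoint Q ∧ ∀ i ∈ s, Q i ⊆ ⋃ j ∈ t, Q j := by
  classical
  induction s using Finset.induction with
  | empty => exact ⟨∅, by simp⟩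
  | insert a s _ ih =>
    obtain ⟨t, hts, hdisj, hcov⟩ := ih
    by_cases h : ∃ b ∈ t, Q a ⊆ Q b
    · obtain ⟨b, hb, hab⟩ := h
      refine ⟨t, hts.trans (Finset.subset_insert _ _), hdisj, fun i hi => ?_⟩
      rcases Finset.mem_insert.1 hi with rfl | hi
      · exact hab.trans (Set.subset_biUnion_of_mem (u := Q) hb)
      · exact hcov i hi
    · push Not at h
      refine ⟨insert a (t.filter fun b => Disjoint (Q a) (Q b)),
        Finset.insert_subset_insert _ ((Finset.filter_subset _ _).trans hts), ?_, ?_⟩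
      · rw [Finset.coe_insert]
        refine (hdisj.subset (fun b hb => (Finset.mem_filter.1 hb).1)).insert fun j hj _ => ?_
        exact (Finset.mem_filter.1 hj).2
      · intro i hi
        rcases Finset.mem_insert.1 hi with rfl | hi
        · exact Set.subset_biUnion_of_mem (u := Q) (Finset.mem_insert_self _ _)
        · refine (hcov i hi).trans (Set.iUnion₂_subset fun b hb => ?_)
          rcases hQ a b with h1 | h1 | h1
          · exact absurd h1 (h b hb)
          · exact h1.trans (Set.subset_biUnion_of_mem (u := Q) (Finset.mem_insert_self _ _))
          · exact Set.subset_biUnion_of_mem (u := Q)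
              (Finset.mem_insert_of_mem (Finset.mem_filter.2 ⟨hb, h1⟩))

theorem mem_dyadicCube_iff {d : ℕ} {k : ℤ} {m : Fin d → ℤ} {x : EuclideanSpace ℝ (Fin d)} :
    x ∈ dyadicCube d k m ↔ ∀ i, ⌊(2 : ℝ) ^ k * x i⌋ = m i := by
  have h2 : (0 : ℝ) < 2 ^ k := by positivity
  refine forall_congr' fun i => ?_
  rw [Int.floor_eq_iff, Set.mem_Ico, zpow_neg, inv_mul_le_iff₀ h2, lt_inv_mul_iff₀ h2]

theorem dyadicCube_subset_or_disjoint {d : ℕ} {k k' : ℤ} (hk : k ≤ k') (m m' : Fin d → ℤ) :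
    dyadicCube d k' m' ⊆ dyadicCube d k m ∨ Disjoint (dyadicCube d k' m') (dyadicCube d k m) := by
  by_contra! h
  obtain ⟨h1, h2⟩ := h
  obtain ⟨x, hx', hx⟩ := Set.not_disjoint_iff.1 h2
  refine h1 fun y hy => ?_
  rw [mem_dyadicCube_iff] at *
  obtain ⟨N, hN⟩ := Int.le.dest hk
  have key : ∀ t : ℝ, ⌊(2 : ℝ) ^ k * t⌋ = ⌊(2 : ℝ) ^ k' * t⌋ / ((2 ^ N : ℕ) : ℤ) := by
    intro t
    rw [← Int.floor_div_natCast, ← hN, zpow_add₀ two_ne_zero]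
    congr 1
    push_cast
    rw [zpow_natCast]
    field_simp
  intro i
  rw [← hx i, key, key, hy i, hx' i]

theorem dyadicCube_laminar {d : ℕ} (k k' : ℤ) (m m' : Fin d → ℤ) :
    dyadicCube d k m ⊆ dyadicCube d k' m' ∨ dyadicCube d k' m' ⊆ dyadicCube d k m ∨
      Disjoint (dyadicCube d k m) (dyadicCube d k' m') := by
  rcases le_total k k' with h | h
  · exact Or.inr ((dyadicCube_subset_or_disjoint h m m').imp_right fun h => h.symm)
  · exact (dyadicCube_subset_or_disjoint h m' m).imp_right Or.inr

theorem measurableSet_dyadicCube (d : ℕ) (k : ℤ) (m : Fin d → ℤ) :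
    MeasurableSet (dyadicCube d k m) := by
  simp only [dyadicCube, Set.ofPred_forall]
  refine MeasurableSet.iInter fun i => ?_
  exact measurableSet_Ico.preimage (by fun_prop : Measurable fun x : EuclideanSpace ℝ (Fin d) => x i)

theorem volume_dyadicCube (d : ℕ) (k : ℤ) (m : Fin d → ℤ) :
    volume (dyadicCube d k m) = ENNReal.ofReal ((2 : ℝ) ^ (-k)) ^ d := by
  have h : dyadicCube d k m = WithLp.ofLp ⁻¹' (Set.univ.pi fun i =>
      Set.Ico ((2 : ℝ) ^ (-k) * m i) ((2 : ℝ) ^ (-k) * (m i + 1))) := by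
    ext x; simp [dyadicCube]
  rw [h, (PiLp.volume_preserving_ofLp (Fin d)).measure_preimage
    (MeasurableSet.univ_pi fun _ => measurableSet_Ico).nullMeasurableSet, Real.volume_pi_Ico]
  simp [mul_add]

/-- Weak-type bound for a finite laminar family. -/
theorem mul_measure_biUnion_le {α ι : Type*} [MeasurableSpace α] {μ ν : Measure α} {Q : ι → Set α}
    (hQ : ∀ i j, Q i ⊆ Q j ∨ Q j ⊆ Q i ∨ Disjoint (Q i) (Q j)) (hm : ∀ i, MeasurableSet (Q i))
    (s : Finset ι) {c : ℝ≥0∞} (hc : ∀ i ∈ s, c * μ (Q i) ≤ ν (Q i)) :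
    c * μ (⋃ i ∈ s, Q i) ≤ ν Set.univ := by
  obtain ⟨t, hts, hdisj, hcov⟩ := exists_pairwiseDisjoint_subfamily Q hQ s
  calc c * μ (⋃ i ∈ s, Q i) ≤ c * ∑ i ∈ t, μ (Q i) := by
        gcongr
        exact (measure_mono (Set.iUnion₂_subset hcov)).trans (measure_biUnion_finset_le _ _)
    _ ≤ ∑ i ∈ t, ν (Q i) := by
        rw [Finset.mul_sum]
        exact Finset.sum_le_sum fun i hi => hc i (hts hi)
    _ = ν (⋃ i ∈ t, Q i) := (measure_biUnion_finset hdisj fun i _ => hm i).symm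
    _ ≤ ν Set.univ := measure_mono (Set.subset_univ _)

/-- Weak-type estimate for the averages of `h` over a laminar family, localized to the set where
`h` is large. -/
theorem sum_measure_le_of_lt_average {α ι : Type*} [MeasurableSpace α] {μ : Measure α}
    {Q E : ι → Set α} (hQ : ∀ i j, Q i ⊆ Q j ∨ Q j ⊆ Q i ∨ Disjoint (Q i) (Q j))
    (hm : ∀ i, MeasurableSet (Q i)) (hQt : ∀ i, μ (Q i) ≠ ⊤)
    (hE : ∀ i, MeasurableSet (E i)) (hEQ : ∀ i, E i ⊆ Q i)
    (hdisj : Pairwise (Function.onFun Disjoint E)) {h : α → ℝ≥0∞} (hh : Measurable h)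
    {T : ℝ≥0∞} (hT : T ≠ ⊤) (s : Finset ι)
    (hs : ∀ i ∈ s, T < (∫⁻ x in Q i, h x ∂μ) / μ (Q i)) :
    T * ∑ i ∈ s, μ (E i) ≤ 2 * ∫⁻ x, Set.indicator {x | T < 2 * h x} h x ∂μ := by
  have hset : MeasurableSet {x | T < 2 * h x} := measurableSet_lt measurable_const (by fun_prop)
  have hc : ∀ i ∈ s, T / 2 * μ (Q i) ≤
      (μ.withDensity (Set.indicator {x | T < 2 * h x} h)) (Q i) := by
    intro i hi
    rw [withDensity_apply _ (hm i)]
    have h1 : T * μ (Q i) ≤ ∫⁻ x in Q i, h x ∂μ := ENNReal.mul_le_of_le_div (hs i hi).le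
    have h2 : ∫⁻ x in Q i, h x ∂μ ≤
        (∫⁻ x in Q i, Set.indicator {x | T < 2 * h x} h x ∂μ) + T / 2 * μ (Q i) := by
      rw [← setLIntegral_const, ← lintegral_add_right _ measurable_const]
      refine lintegral_mono fun x => ?_
      by_cases hx : T < 2 * h x
      · rw [Set.indicator_of_mem (by exact hx)]
        exact le_self_add
      · rw [Set.indicator_of_notMem (by exact hx), zero_add,
          ENNReal.le_div_iff_mul_le (by simp) (by simp), mul_comm]
        exact not_lt.1 hx
    have h3 : T / 2 * μ (Q i) ≠ ⊤ :=
      ENNReal.mul_ne_top (ENNReal.div_ne_top hT two_ne_zero) (hQt i)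
    refine (ENNReal.add_le_add_iff_right h3).1 ?_
    rw [← add_mul, ENNReal.add_halves]
    exact h1.trans h2
  have key := mul_measure_biUnion_le hQ hm s hc
  rw [withDensity_apply _ MeasurableSet.univ, Measure.restrict_univ] at key
  calc T * ∑ i ∈ s, μ (E i) = T * μ (⋃ i ∈ s, E i) := by
        rw [measure_biUnion_finset (hdisj.set_pairwise _) fun i _ => hE i]
    _ ≤ T * μ (⋃ i ∈ s, Q i) := by
        gcongr with i
        exact hEQ i
    _ = 2 * (T / 2 * μ (⋃ i ∈ s, Q i)) := by
        rw [← mul_assoc, ENNReal.mul_div_cancel two_ne_zero ENNReal.ofNat_ne_top]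
    _ ≤ _ := by gcongr

/-- Carleson embedding theorem for a finite laminar family, with disjoint portions `E i ⊆ Q i`. -/
theorem sum_measure_mul_average_rpow_le {α ι : Type*} [MeasurableSpace α] {μ : Measure α}
    [SFinite μ] {Q E : ι → Set α} (hQ : ∀ i j, Q i ⊆ Q j ∨ Q j ⊆ Q i ∨ Disjoint (Q i) (Q j))
    (hm : ∀ i, MeasurableSet (Q i)) (hQt : ∀ i, μ (Q i) ≠ ⊤)
    (hE : ∀ i, MeasurableSet (E i)) (hEQ : ∀ i, E i ⊆ Q i)
    (hdisj : Pairwise (Function.onFun Disjoint E)) {h : α → ℝ≥0∞} (hh : Measurable h)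
    {r : ℝ} (hr : 1 < r) (s : Finset ι) :
    ∑ i ∈ s, μ (E i) * ((∫⁻ x in Q i, h x ∂μ) / μ (Q i)) ^ r ≤
      ENNReal.ofReal r * (2 * 2 ^ (r - 1) / ENNReal.ofReal (r - 1)) * ∫⁻ x, h x ^ r ∂μ := by
  classical
  have hr0 : 0 < r := by linarith
  have hr1 : 0 < r - 1 := by linarith
  set A : ι → ℝ≥0∞ := fun i => (∫⁻ x in Q i, h x ∂μ) / μ (Q i) with hA
  set L : ℝ → ℝ≥0∞ → ℝ → ℝ≥0∞ := fun q x =>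
    Set.indicator {t : ℝ | ENNReal.ofReal t < x} (fun t => ENNReal.ofReal (t ^ (q - 1))) with hL
  have hLm : ∀ q x, Measurable (L q x) := fun q x =>
    Measurable.indicator (by fun_prop) (measurableSet_lt (by fun_prop) measurable_const)
  have hLm2 : Measurable fun z : ℝ × α => h z.2 * L (r - 1) (2 * h z.2) z.1 := by
    refine Measurable.mul (by fun_prop) ?_
    exact Measurable.indicator (s := {z : ℝ × α | ENNReal.ofReal z.1 < 2 * h z.2})
      (f := fun z => ENNReal.ofReal (z.1 ^ (r - 1 - 1))) (by fun_prop)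
      (measurableSet_lt (by fun_prop) (by fun_prop))
  have hpt : ∀ t ∈ Set.Ioi (0 : ℝ), ∑ i ∈ s, μ (E i) * L r (A i) t ≤
      2 * ∫⁻ x, h x * L (r - 1) (2 * h x) t ∂μ := by
    intro t ht
    have ht0 : 0 < t := ht
    have h1 := sum_measure_le_of_lt_average hQ hm hQt hE hEQ hdisj hh
      (T := ENNReal.ofReal t) ENNReal.ofReal_ne_top (s.filter fun i => ENNReal.ofReal t < A i)
      (fun i hi => (Finset.mem_filter.1 hi).2)
    calc ∑ i ∈ s, μ (E i) * L r (A i) t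
        = ENNReal.ofReal (t ^ (r - 1 - 1)) *
          (ENNReal.ofReal t * ∑ i ∈ s with ENNReal.ofReal t < A i, μ (E i)) := by
          rw [← mul_assoc, ← ENNReal.ofReal_mul (by positivity), ← Real.rpow_add_one ht0.ne',
            sub_add_cancel, Finset.sum_filter, Finset.mul_sum]
          refine Finset.sum_congr rfl fun i _ => ?_
          by_cases hi : ENNReal.ofReal t < A i
          · simp [hL, hi, mul_comm]
          · simp [hL, hi]
      _ ≤ ENNReal.ofReal (t ^ (r - 1 - 1)) *
          (2 * ∫⁻ x, Set.indicator {x | ENNReal.ofReal t < 2 * h x} h x ∂μ) := by gcongr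
      _ = _ := by
          rw [mul_left_comm, ← lintegral_const_mul _ (hh.indicator
            (measurableSet_lt measurable_const (by fun_prop)))]
          congr 1
          refine lintegral_congr fun x => ?_
          by_cases hx : ENNReal.ofReal t < 2 * h x
          · simp only [hL]
            rw [Set.indicator_of_mem (by exact hx), Set.indicator_of_mem (by exact hx), mul_comm]
          · simp [hL, hx]
  have hr0' : ENNReal.ofReal r ≠ 0 := by simpa using hr0
  calc ∑ i ∈ s, μ (E i) * A i ^ r
      = ENNReal.ofReal r * ∫⁻ t in Set.Ioi (0 : ℝ), ∑ i ∈ s, μ (E i) * L r (A i) t := by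
        rw [lintegral_finsetSum _ fun i _ => (hLm r (A i)).const_mul _, Finset.mul_sum]
        refine Finset.sum_congr rfl fun i _ => ?_
        rw [lintegral_const_mul _ (hLm r (A i)), lintegral_indicator_rpow hr0, mul_left_comm,
          ENNReal.mul_div_cancel hr0' ENNReal.ofReal_ne_top]
    _ ≤ ENNReal.ofReal r * ∫⁻ t in Set.Ioi (0 : ℝ),
          2 * ∫⁻ x, h x * L (r - 1) (2 * h x) t ∂μ := by
        gcongr 1
        exact setLIntegral_mono' measurableSet_Ioi hpt
    _ = ENNReal.ofReal r * (2 * ∫⁻ x, h x * ((2 * h x) ^ (r - 1) / ENNReal.ofReal (r - 1)) ∂μ) := by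
        rw [lintegral_const_mul _ hLm2.lintegral_prod_right',
          lintegral_lintegral_swap hLm2.aemeasurable]
        congr 2
        refine lintegral_congr fun x => ?_
        exact (lintegral_const_mul (h x) (hLm _ (2 * h x))).trans (by rw [lintegral_indicator_rpow hr1])
    _ = _ := by
        rw [mul_assoc, ← lintegral_const_mul _ (by fun_prop), ← lintegral_const_mul _ (hh.pow_const r)]
        congr 1
        refine lintegral_congr fun x => ?_
        have hx : h x ^ r = h x * h x ^ (r - 1) := by
          conv_rhs => rw [← ENNReal.rpow_one (h x), ← ENNReal.rpow_mul, one_mul,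
            ← ENNReal.rpow_add_of_nonneg _ _ zero_le_one hr1.le, add_sub_cancel]
        rw [hx, ENNReal.mul_rpow_of_nonneg _ _ hr1.le]
        simp only [div_eq_mul_inv]
        ring

/-- Carleson embedding for a sparse family of dyadic cubes. -/
theorem sum_volume_mul_average_rpow_le {d : ℕ} {ι : Type*} {k : ι → ℤ} {m : ι → Fin d → ℤ}
    {E : ι → Set (EuclideanSpace ℝ (Fin d))} (hE : ∀ j, MeasurableSet (E j))
    (hEQ : ∀ j, E j ⊆ dyadicCube d (k j) (m j)) {η : ℝ} (hη : 0 < η)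
    (hsparse : ∀ j, ENNReal.ofReal η * volume (dyadicCube d (k j) (m j)) ≤ volume (E j))
    (hdisj : Pairwise (Function.onFun Disjoint E))
    {h : EuclideanSpace ℝ (Fin d) → ℝ≥0∞} (hh : Measurable h) {r : ℝ} (hr : 1 < r)
    (s : Finset ι) :
    ∑ j ∈ s, volume (dyadicCube d (k j) (m j)) *
        ((∫⁻ x in dyadicCube d (k j) (m j), h x) / volume (dyadicCube d (k j) (m j))) ^ r ≤
      (ENNReal.ofReal η)⁻¹ * (ENNReal.ofReal r * (2 * 2 ^ (r - 1) / ENNReal.ofReal (r - 1))) *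
        ∫⁻ x, h x ^ r := by
  have hη' : ENNReal.ofReal η ≠ 0 := by simpa using hη
  have key := sum_measure_mul_average_rpow_le (μ := volume)
    (fun i j => dyadicCube_laminar (k i) (k j) (m i) (m j))
    (fun i => measurableSet_dyadicCube d (k i) (m i))
    (fun i => by rw [volume_dyadicCube]; exact ENNReal.pow_ne_top ENNReal.ofReal_ne_top)
    hE hEQ hdisj hh hr s
  rw [mul_assoc]
  refine le_trans ?_ (mul_le_mul_right key _)
  rw [Finset.mul_sum]
  refine Finset.sum_le_sum fun j _ => ?_
  rw [← mul_assoc]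
  gcongr
  rw [← ENNReal.div_eq_inv_mul, ENNReal.le_div_iff_mul_le (Or.inl hη') (by simp), mul_comm]
  exact hsparse j

/-- Hölder's inequality for `f * σ` on a set `S`, in normalized form. -/
theorem setLIntegral_mul_le_average {α : Type*} [MeasurableSpace α] {μ : Measure α} {S : Set α}
    (hS0 : μ S ≠ 0) (hSt : μ S ≠ ⊤) {f σ : α → ℝ≥0∞} (hf : Measurable f) (hσ : Measurable σ)
    {p θ a : ℝ} (hp : 1 < p) (hθ : 0 < θ) (ha0 : 0 < a) (ha : a = 1 - (1 - 1 / p) / θ) :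
    ∫⁻ x in S, f x * σ x ∂μ ≤
      μ S * (((∫⁻ x in S, (f x ^ p * σ x) ^ (1 / (p * a)) ∂μ) / μ S) ^ (p * a)) ^ (1 / p) *
        ((∫⁻ x in S, σ x ^ θ ∂μ) / μ S) ^ ((1 - 1 / p) / θ) := by
  have hp0 : 0 < p := by linarith
  have hp1 : 0 ≤ 1 - 1 / p := by
    rw [sub_nonneg, div_le_one hp0]; exact hp.le
  set b := (1 - 1 / p) / θ with hb
  have hb0 : 0 ≤ b := div_nonneg hp1 hθ.le
  have hab : a + b = 1 := by rw [ha]; ring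
  have hpt : ∀ x, f x * σ x = ((f x ^ p * σ x) ^ (1 / (p * a))) ^ a * (σ x ^ θ) ^ b := by
    intro x
    have e1 : 1 / (p * a) * a = 1 / p := by field_simp
    have e2 : θ * b = 1 - 1 / p := by rw [hb]; field_simp
    rw [← ENNReal.rpow_mul, ← ENNReal.rpow_mul, e1, e2,
      ENNReal.mul_rpow_of_nonneg _ _ (by positivity), ← ENNReal.rpow_mul,
      mul_one_div_cancel hp0.ne', ENNReal.rpow_one, mul_assoc,
      ← ENNReal.rpow_add_of_nonneg _ _ (by positivity) hp1, add_sub_cancel, ENNReal.rpow_one]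
  have hvol : ∀ (c : ℝ≥0∞) (e : ℝ), 0 ≤ e → c ^ e = μ S ^ e * (c / μ S) ^ e := by
    intro c e he
    rw [← ENNReal.mul_rpow_of_nonneg _ _ he, ENNReal.mul_div_cancel hS0 hSt]
  have e3 : p * a * (1 / p) = a := by field_simp
  rw [← ENNReal.rpow_mul, e3]
  simp_rw [hpt]
  refine (ENNReal.lintegral_mul_norm_pow_le (by fun_prop) (by fun_prop) ha0.le hb0 hab).trans
    (le_of_eq ?_)
  rw [hvol _ a ha0.le, hvol _ b hb0, mul_mul_mul_comm, ← ENNReal.rpow_add_of_nonneg _ _ ha0.le hb0,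
    hab, ENNReal.rpow_one, mul_assoc]

end SparseEmbedding
/-- Theorem 2.1(b): for `θ > 1` and `∑ 1/pᵢ ≥ 1`, if
`A₀ = sup_S K(S)|S|^{n-∑1/pᵢ} ∏ ((∫_S σᵢ^θ)/|S|)^{1/(θpᵢ')} < ∞`
(here `1/(θpᵢ') = (1 - 1/pᵢ)/θ`), then the multilinear embedding inequality holds,
with no `A_∞` assumption on the `σᵢ`. -/
theorem stmt7 (d n : ℕ) (hn : 0 < n) (p : Fin n → ℝ) (hp : ∀ i, 1 < p i)
    (hsum : 1 ≤ ∑ i, 1 / p i) (θ : ℝ) (hθ : 1 < θ) (η : ℝ) (hη0 : 0 < η) (hη1 : η < 1) :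
    ∃ C : ℝ≥0∞, C ≠ ⊤ ∧
      ∀ (ι : Type) (_ : Countable ι) (k : ι → ℤ) (m : ι → Fin d → ℤ)
        (E : ι → Set (EuclideanSpace ℝ (Fin d)))
        (_ : ∀ j, MeasurableSet (E j))
        (_ : ∀ j, E j ⊆ dyadicCube d (k j) (m j))
        (_ : ∀ j, ENNReal.ofReal η * volume (dyadicCube d (k j) (m j)) ≤ volume (E j))
        (_ : Pairwise (Function.onFun Disjoint E))
        (σ : Fin n → EuclideanSpace ℝ (Fin d) → ℝ≥0∞) (_ : ∀ i, Measurable (σ i))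
        (K : ι → ℝ≥0∞) (A₀ : ℝ≥0∞) (_ : A₀ ≠ ⊤)
        (_ : ∀ j, K j * volume (dyadicCube d (k j) (m j)) ^ ((n : ℝ) - ∑ i, 1 / p i) *
            ∏ i, ((∫⁻ x in dyadicCube d (k j) (m j), σ i x ^ θ) /
              volume (dyadicCube d (k j) (m j))) ^ ((1 - 1 / p i) / θ) ≤ A₀)
        (f : Fin n → EuclideanSpace ℝ (Fin d) → ℝ≥0∞) (_ : ∀ i, Measurable (f i)),
        (∑' j, K j * ∏ i, ∫⁻ x in dyadicCube d (k j) (m j), f i x * σ i x) ≤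
          C * A₀ * ∏ i, (∫⁻ x, f i x ^ p i * σ i x) ^ (1 / p i) := by
  classical
  set a : Fin n → ℝ := fun i => 1 - (1 - 1 / p i) / θ with ha
  have hp0 : ∀ i, 0 < p i := fun i => by linarith [hp i]
  have hθ0 : 0 < θ := by linarith
  have hap : ∀ i, 1 / p i < a i := by
    intro i
    have h1 : 1 / p i < 1 := by rw [div_lt_one (hp0 i)]; exact hp i
    have h2 : (1 - 1 / p i) / θ < 1 - 1 / p i := div_lt_self (by linarith) hθ
    simp only [ha]
    linarith
  have ha0 : ∀ i, 0 < a i := fun i => (one_div_pos.2 (hp0 i)).trans (hap i)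
  have hr : ∀ i, 1 < p i * a i := by
    intro i
    have := hap i
    rwa [div_lt_iff₀' (hp0 i)] at this
  set c : Fin n → ℝ≥0∞ := fun i => (ENNReal.ofReal η)⁻¹ *
    (ENNReal.ofReal (p i * a i) * (2 * 2 ^ (p i * a i - 1) / ENNReal.ofReal (p i * a i - 1))) with hc
  have hct : ∀ i, c i ≠ ⊤ := by
    intro i
    have h1 : ENNReal.ofReal (p i * a i - 1) ≠ 0 := by simpa using hr i
    have h2 : (2 : ℝ≥0∞) ^ (p i * a i - 1) ≠ ⊤ :=
      ENNReal.rpow_ne_top_of_nonneg (by linarith [hr i]) ENNReal.ofNat_ne_top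
    exact ENNReal.mul_ne_top (ENNReal.inv_ne_top.2 (by simpa using hη0))
      (ENNReal.mul_ne_top ENNReal.ofReal_ne_top
        (ENNReal.div_ne_top (ENNReal.mul_ne_top ENNReal.ofNat_ne_top h2) h1))
  refine ⟨∏ i, c i ^ (1 / p i), ENNReal.prod_ne_top fun i _ =>
    ENNReal.rpow_ne_top_of_nonneg (one_div_nonneg.2 (hp0 i).le) (hct i), ?_⟩
  intro ι _ k m E hE hEQ hsparse hdisj σ hσ K A₀ _ hA f hf
  set V : ι → ℝ≥0∞ := fun j => volume (dyadicCube d (k j) (m j)) with hV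
  have hV0 : ∀ j, V j ≠ 0 := fun j => by
    simp only [hV, SparseEmbedding.volume_dyadicCube]
    exact pow_ne_zero _ (by simpa using zpow_pos (two_pos : (0 : ℝ) < 2) _)
  have hVt : ∀ j, V j ≠ ⊤ := fun j => by
    simp only [hV, SparseEmbedding.volume_dyadicCube]
    exact ENNReal.pow_ne_top ENNReal.ofReal_ne_top
  set B : Fin n → ι → ℝ≥0∞ := fun i j =>
    ((∫⁻ x in dyadicCube d (k j) (m j), (f i x ^ p i * σ i x) ^ (1 / (p i * a i))) / V j) ^
      (p i * a i) with hB
  have hterm : ∀ j, K j * ∏ i, ∫⁻ x in dyadicCube d (k j) (m j), f i x * σ i x ≤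
      A₀ * ∏ i, (V j * B i j) ^ (1 / p i) := by
    intro j
    set D : Fin n → ℝ≥0∞ := fun i =>
      ((∫⁻ x in dyadicCube d (k j) (m j), σ i x ^ θ) / V j) ^ ((1 - 1 / p i) / θ) with hD
    have hVpow : V j ^ n = V j ^ ((n : ℝ) - ∑ i, 1 / p i) * ∏ i, V j ^ (1 / p i) := by
      rw [← SparseEmbedding.rpow_sum (hV0 j) (hVt j), ← ENNReal.rpow_add _ _ (hV0 j) (hVt j),
        sub_add_cancel, ENNReal.rpow_natCast]
    calc K j * ∏ i, ∫⁻ x in dyadicCube d (k j) (m j), f i x * σ i x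
        ≤ K j * ∏ i, (V j * B i j ^ (1 / p i) * D i) := by
          gcongr with i
          exact SparseEmbedding.setLIntegral_mul_le_average (hV0 j) (hVt j) (hf i) (hσ i) (hp i)
            hθ0 (ha0 i) rfl
      _ = (K j * V j ^ ((n : ℝ) - ∑ i, 1 / p i) * ∏ i, D i) *
            ∏ i, (V j * B i j) ^ (1 / p i) := by
          simp only [ENNReal.mul_rpow_of_nonneg _ _ (one_div_nonneg.2 (hp0 _).le),
            Finset.prod_mul_distrib, Finset.prod_const, Finset.card_univ, Fintype.card_fin, hVpow]
          ring
      _ ≤ _ := by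
          gcongr
          exact hA j
  rw [ENNReal.tsum_eq_iSup_sum]
  refine iSup_le fun s => ?_
  calc ∑ j ∈ s, K j * ∏ i, ∫⁻ x in dyadicCube d (k j) (m j), f i x * σ i x
      ≤ A₀ * ∑ j ∈ s, ∏ i, (V j * B i j) ^ (1 / p i) := by
        rw [Finset.mul_sum]
        exact Finset.sum_le_sum fun j _ => hterm j
    _ ≤ A₀ * ∏ i, (∑ j ∈ s, V j * B i j) ^ (1 / p i) := by
        gcongr
        exact SparseEmbedding.sum_prod_rpow_le s (fun i j => V j * B i j)
          (fun i => one_div_nonneg.2 (hp0 i).le) hsum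
    _ ≤ A₀ * ∏ i, (c i * ∫⁻ x, f i x ^ p i * σ i x) ^ (1 / p i) := by
        gcongr with i
        · exact one_div_nonneg.2 (hp0 i).le
        have h := SparseEmbedding.sum_volume_mul_average_rpow_le hE hEQ hη0 hsparse hdisj
          (h := fun x => (f i x ^ p i * σ i x) ^ (1 / (p i * a i)))
          (((hf i).pow_const _ |>.mul (hσ i)).pow_const _) (hr i) s
        have hpa : 1 / (p i * a i) * (p i * a i) = 1 :=
          one_div_mul_cancel (by linarith [hr i])
        simpa only [← ENNReal.rpow_mul, hpa, ENNReal.rpow_one] using h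
    _ = _ := by
        simp only [ENNReal.mul_rpow_of_nonneg _ _ (one_div_nonneg.2 (hp0 _).le),
          Finset.prod_mul_distrib]
        ring
end
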